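/- Let t ∈ ℝ satisfy c₀^t < e^{P(t)} and c₁^t < e^{P(t)}. Then there exist a constant K₃ > 0 and N ∈ ℕ such that for every integer n ≥ N there exists an integer l with n − N ≤ l ≤ n and K₃·e^{l·P(t)} ≤ ∑_{ω ∈ G_l} c_ω^t. -/

import Mathlib

open Filter

/-- The weight `c_ω` of a word `ω` over the alphabet `{0,1}` (here `false` is the
letter 0 and `true` is the letter 1): the product of `c0` over letters 0 and `c1`
over letters 1. -/
noncomputable def wt (c0 c1 : ℝ) (w : List Bool) : ℝ :=
  (w.map fun b => if b then c1 else c0).prod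

/-- All words of length `n` over the alphabet `{0,1}`. -/
def allWords : ℕ → Finset (List Bool)
  | 0 => {[]}
  | n + 1 => (allWords n).biUnion fun w => {false :: w, true :: w}

/-- Membership in the language of the S-gap shift: every maximal block of 0s lying
strictly between two 1s has length in `S`. -/
def InLang (S : Set ℕ) (w : List Bool) : Prop :=
  ∀ u v : List Bool, ∀ m : ℕ,
    w = u ++ [true] ++ List.replicate m false ++ [true] ++ v → m ∈ S

/-- Membership in the core set `G`: words of the form `0^{s₁}1 0^{s₂}1 ⋯ 0^{s_k}1`
with `k ≥ 1` and every `s_i ∈ S`. -/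
def InCore (S : Set ℕ) (w : List Bool) : Prop :=
  ∃ bs : List ℕ, bs ≠ [] ∧ (∀ s ∈ bs, s ∈ S) ∧
    w = (bs.map fun s => List.replicate s false ++ [true]).flatten

/-- `L_n`: the words of length `n` in the language of the S-gap shift. -/
noncomputable def langWords (S : Set ℕ) (n : ℕ) : Finset (List Bool) :=
  @Finset.filter _ (InLang S) (Classical.decPred _) (allWords n)

/-- `G_n`: the core words of length `n`. -/
noncomputable def coreWords (S : Set ℕ) (n : ℕ) : Finset (List Bool) :=
  @Finset.filter _ (InCore S) (Classical.decPred _) (allWords n)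

/-- The concatenation `0^{s₁}1 0^{s₂}1 ⋯ 0^{s_k}1` of the blocks given by a list of gaps. -/
def gapWord (bs : List ℕ) : List Bool :=
  (bs.map fun s => List.replicate s false ++ [true]).flatten

/-- Words that are empty or core words. -/
def InFree (S : Set ℕ) (w : List Bool) : Prop :=
  ∃ bs : List ℕ, (∀ s ∈ bs, s ∈ S) ∧ w = gapWord bs

/-- The words of length `n` that are empty or core words. -/
noncomputable def freeWords (S : Set ℕ) (n : ℕ) : Finset (List Bool) :=
  @Finset.filter _ (InFree S) (Classical.decPred _) (allWords n)

@[simp] lemma gapWord_nil : gapWord [] = [] := rfl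

@[simp] lemma gapWord_cons (s : ℕ) (bs : List ℕ) :
    gapWord (s :: bs) = List.replicate s false ++ true :: gapWord bs := by
  simp [gapWord]

@[simp] lemma gapWord_append (bs cs : List ℕ) :
    gapWord (bs ++ cs) = gapWord bs ++ gapWord cs := by
  simp [gapWord]

lemma mem_allWords {n : ℕ} {w : List Bool} : w ∈ allWords n ↔ w.length = n := by
  induction n generalizing w with
  | zero => simp [allWords]
  | succ n ih =>
    rw [allWords, Finset.mem_biUnion]
    constructor
    · rintro ⟨v, hv, hw⟩
      rw [ih] at hv
      simp only [Finset.mem_insert, Finset.mem_singleton] at hw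
      rcases hw with rfl | rfl <;> simp [hv]
    · intro h
      cases w with
      | nil => simp at h
      | cons x v =>
        refine ⟨v, ih.2 (by simpa using h), ?_⟩
        cases x <;> simp

lemma mem_langWords {S : Set ℕ} {n : ℕ} {w : List Bool} :
    w ∈ langWords S n ↔ w.length = n ∧ InLang S w := by
  simp [langWords, mem_allWords]

lemma mem_freeWords {S : Set ℕ} {n : ℕ} {w : List Bool} :
    w ∈ freeWords S n ↔ w.length = n ∧ InFree S w := by
  simp [freeWords, mem_allWords]

lemma freeWords_eq_coreWords (S : Set ℕ) {n : ℕ} (hn : 1 ≤ n) :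
    freeWords S n = coreWords S n := by
  ext w
  simp only [freeWords, coreWords, Finset.mem_filter, mem_allWords, InFree, InCore]
  constructor
  · rintro ⟨hl, bs, hS, rfl⟩
    refine ⟨hl, bs, ?_, hS, rfl⟩
    rintro rfl
    simp at hl
    omega
  · rintro ⟨hl, bs, -, hS, rfl⟩
    exact ⟨hl, bs, hS, rfl⟩

lemma replicate_false_append_true_inj {m s : ℕ} {v w : List Bool}
    (h : List.replicate m false ++ true :: v = List.replicate s false ++ true :: w) :
    m = s ∧ v = w := by
  induction m generalizing s with
  | zero => cases s <;> simp_all [List.replicate_succ]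
  | succ m ih =>
    cases s with
    | zero => simp [List.replicate_succ] at h
    | succ s =>
      simp only [List.replicate_succ, List.cons_append, List.cons.injEq, true_and] at h
      simpa using ih h

lemma InFree.inLang {S : Set ℕ} {w : List Bool} (h : InFree S w) : InLang S w := by
  obtain ⟨bs, hS, rfl⟩ := h
  induction bs with
  | nil => intro u v m h; simp at h
  | cons s bs ih =>
    intro u v m h
    have ih := ih fun x hx => hS x (List.mem_cons_of_mem _ hx)
    simp only [gapWord_cons, List.append_assoc, List.cons_append, List.nil_append] at h
    rw [List.append_eq_append_iff] at h
    rcases h with ⟨as, hu, h⟩ | ⟨as, hs, h⟩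
    · cases as with
      | nil =>
        simp only [List.nil_append, List.cons.injEq, true_and] at h
        cases bs with
        | nil => simp at h
        | cons s' bs =>
          rw [gapWord_cons] at h
          rw [← (replicate_false_append_true_inj h).1]
          exact hS s' (by simp)
      | cons x as =>
        simp only [List.cons_append, List.cons.injEq] at h
        exact ih as v m (by simpa using h.2)
    · cases as with
      | nil =>
        simp only [List.nil_append, List.cons.injEq, true_and] at h
        cases bs with
        | nil => simp at h
        | cons s' bs =>
          rw [gapWord_cons] at h
          rw [(replicate_false_append_true_inj h).1]
          exact hS s' (by simp)
      | cons x as =>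
        simp only [List.cons_append, List.cons.injEq] at h
        have hx : x ∈ List.replicate s false := by rw [hs]; simp
        rw [List.mem_replicate] at hx
        simp [hx.2] at h

lemma InLang.of_infix {S : Set ℕ} {p w q : List Bool} (h : InLang S (p ++ w ++ q)) :
    InLang S w := by
  intro u v m hw
  exact h (p ++ u) (v ++ q) m (by simp [hw])

lemma exists_gapWord_append_replicate (w : List Bool) :
    ∃ bs j, w = gapWord bs ++ List.replicate j false := by
  induction w with
  | nil => exact ⟨[], 0, rfl⟩
  | cons x w ih =>
    obtain ⟨bs, j, rfl⟩ := ih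
    cases x with
    | true => exact ⟨0 :: bs, j, by simp⟩
    | false =>
      cases bs with
      | nil => exact ⟨[], j + 1, by simp [List.replicate_succ]⟩
      | cons s bs => exact ⟨(s + 1) :: bs, j, by simp [List.replicate_succ]⟩

lemma exists_gapWord_cons_eq_append_true (i : ℕ) (bs : List ℕ) :
    ∃ u, gapWord (i :: bs) = u ++ [true] := by
  induction bs generalizing i with
  | nil => exact ⟨List.replicate i false, by simp⟩
  | cons s bs ih =>
    obtain ⟨u, hu⟩ := ih s
    exact ⟨List.replicate i false ++ true :: u, by rw [gapWord_cons, hu]; simp⟩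

lemma InLang.eq_replicate_or_decomp {S : Set ℕ} {w : List Bool} (h : InLang S w) :
    w = List.replicate w.length false ∨ ∃ i j v, InFree S v ∧
      w = List.replicate i false ++ true :: v ++ List.replicate j false := by
  obtain ⟨bs, j, rfl⟩ := exists_gapWord_append_replicate w
  cases bs with
  | nil => left; simp
  | cons i bs =>
    refine Or.inr ⟨i, j, gapWord bs, ⟨bs, fun s hs => ?_, rfl⟩, by simp⟩
    obtain ⟨l₁, l₂, rfl⟩ := List.append_of_mem hs
    obtain ⟨u, hu⟩ := exists_gapWord_cons_eq_append_true i l₁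
    refine h u (gapWord l₂ ++ List.replicate j false) s ?_
    rw [← List.cons_append, gapWord_append, hu]
    simp

section Weights

variable {a b : ℝ}

@[simp] lemma wt_nil : wt a b [] = 1 := by simp [wt]

@[simp] lemma wt_append (u v : List Bool) : wt a b (u ++ v) = wt a b u * wt a b v := by
  simp [wt]

@[simp] lemma wt_cons_true (v : List Bool) : wt a b (true :: v) = b * wt a b v := by
  simp [wt]

@[simp] lemma wt_replicate_false (n : ℕ) : wt a b (List.replicate n false) = a ^ n := by
  simp [wt]

lemma wt_pos (ha : 0 < a) (hb : 0 < b) (w : List Bool) : 0 < wt a b w := by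
  refine List.prod_pos ?_
  simp only [List.mem_map]
  rintro _ ⟨x, -, rfl⟩
  split_ifs <;> assumption

lemma wt_rpow (ha : 0 < a) (hb : 0 < b) (t : ℝ) (w : List Bool) :
    wt a b w ^ t = wt (a ^ t) (b ^ t) w := by
  induction w with
  | nil => simp
  | cons x w ih =>
    have h := (wt_pos ha hb w).le
    cases x
    · rw [← List.singleton_append, ← List.replicate_one, wt_append, wt_append, wt_replicate_false,
        wt_replicate_false, Real.mul_rpow (by positivity) h, ih]
      simp
    · rw [wt_cons_true, wt_cons_true, Real.mul_rpow hb.le h, ih]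

/-- The sum of the weights of the language words of length `n`. -/
noncomputable def langSum (S : Set ℕ) (a b : ℝ) (n : ℕ) : ℝ :=
  ∑ w ∈ langWords S n, wt a b w

/-- The sum of the weights of the words of length `n` that are empty or core words. -/
noncomputable def freeSum (S : Set ℕ) (a b : ℝ) (n : ℕ) : ℝ :=
  ∑ w ∈ freeWords S n, wt a b w

variable (S : Set ℕ)

lemma langSum_pos (ha : 0 < a) (hb : 0 < b) (n : ℕ) : 0 < langSum S a b n := by
  refine Finset.sum_pos (fun w _ => wt_pos ha hb w) ⟨List.replicate n false, ?_⟩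
  rw [mem_langWords]
  refine ⟨by simp, fun u v m h => ?_⟩
  have : true ∈ List.replicate n false := by rw [h]; simp
  simp [List.mem_replicate] at this

lemma freeSum_nonneg (ha : 0 < a) (hb : 0 < b) (n : ℕ) : 0 ≤ freeSum S a b n :=
  Finset.sum_nonneg fun w _ => (wt_pos ha hb w).le

lemma freeSum_le_langSum (ha : 0 < a) (hb : 0 < b) (n : ℕ) :
    freeSum S a b n ≤ langSum S a b n := by
  refine Finset.sum_le_sum_of_subset_of_nonneg (fun w hw => ?_) fun w _ _ => (wt_pos ha hb w).le
  rw [mem_freeWords] at hw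
  exact mem_langWords.2 ⟨hw.1, hw.2.inLang⟩

lemma langSum_zero : langSum S a b 0 ≤ 1 := by
  have h : langWords S 0 ⊆ {[]} := fun w hw => by
    simpa using (mem_langWords.1 hw).1
  rcases Finset.subset_singleton_iff.1 h with h | h <;> simp [langSum, h]

lemma freeSum_zero : freeSum S a b 0 = 1 := by
  have h : freeWords S 0 = {[]} := by
    ext w
    simp only [mem_freeWords, List.length_eq_zero_iff, Finset.mem_singleton]
    exact ⟨fun h => h.1, fun h => ⟨h, [], by simp, by simp [h]⟩⟩
  simp [freeSum, h]

lemma append_injOn (A B : Finset (List Bool)) {m : ℕ} (hA : ∀ w ∈ A, w.length = m) :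
    Set.InjOn (fun p : List Bool × List Bool => p.1 ++ p.2) (A ×ˢ B : Finset _) := by
  rintro ⟨u, v⟩ h ⟨u', v'⟩ h' heq
  simp only [Finset.coe_product, Set.mem_prod, Finset.mem_coe] at h h'
  have := List.append_inj heq (by rw [hA u h.1, hA u' h'.1])
  exact Prod.ext this.1 this.2

lemma langSum_add_le (ha : 0 < a) (hb : 0 < b) (m n : ℕ) :
    langSum S a b (m + n) ≤ langSum S a b m * langSum S a b n := by
  rw [langSum, langSum, langSum, Finset.sum_mul_sum, ← Finset.sum_product']
  simp_rw [← wt_append]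
  rw [← Finset.sum_image (f := wt a b)
    (append_injOn _ _ fun w hw => (mem_langWords.1 hw).1)]
  refine Finset.sum_le_sum_of_subset_of_nonneg (fun w hw => ?_) fun w _ _ => (wt_pos ha hb w).le
  rw [mem_langWords] at hw
  rw [Finset.mem_image]
  refine ⟨(w.take m, w.drop m), ?_, List.take_append_drop m w⟩
  rw [Finset.mem_product, mem_langWords, mem_langWords]
  refine ⟨⟨by simp [hw.1], ?_⟩, by simp [hw.1], ?_⟩
  · exact InLang.of_infix (p := []) (q := w.drop m) (by simpa using hw.2)
  · exact InLang.of_infix (p := w.take m) (q := []) (by simpa using hw.2)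

lemma le_freeSum_add (ha : 0 < a) (hb : 0 < b) (m n : ℕ) :
    freeSum S a b m * freeSum S a b n ≤ freeSum S a b (m + n) := by
  rw [freeSum, freeSum, freeSum, Finset.sum_mul_sum, ← Finset.sum_product']
  simp_rw [← wt_append]
  rw [← Finset.sum_image (f := wt a b)
    (append_injOn _ _ fun w hw => (mem_freeWords.1 hw).1)]
  refine Finset.sum_le_sum_of_subset_of_nonneg (fun w hw => ?_) fun w _ _ => (wt_pos ha hb w).le
  rw [Finset.mem_image] at hw
  obtain ⟨⟨u, v⟩, huv, rfl⟩ := hw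
  rw [Finset.mem_product, mem_freeWords, mem_freeWords] at huv
  obtain ⟨⟨hu, bs, hbs, rfl⟩, hv, cs, hcs, rfl⟩ := huv
  refine mem_freeWords.2 ⟨by simp_all, bs ++ cs, ?_, by simp⟩
  simp only [List.mem_append]
  rintro s (hs | hs)
  exacts [hbs s hs, hcs s hs]

lemma langSum_mul_le (ha : 0 < a) (hb : 0 < b) (n k : ℕ) :
    langSum S a b (k * n) ≤ langSum S a b n ^ k := by
  induction k with
  | zero => simpa using langSum_zero S
  | succ k ih =>
    rw [Nat.succ_mul, pow_succ]
    exact (langSum_add_le S ha hb _ _).trans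
      (mul_le_mul_of_nonneg_right ih (langSum_pos S ha hb n).le)

lemma le_freeSum_mul (ha : 0 < a) (hb : 0 < b) (n k : ℕ) :
    freeSum S a b n ^ k ≤ freeSum S a b (k * n) := by
  induction k with
  | zero => simp [freeSum_zero]
  | succ k ih =>
    rw [Nat.succ_mul, pow_succ]
    exact (mul_le_mul_of_nonneg_right ih (freeSum_nonneg S ha hb n)).trans
      (le_freeSum_add S ha hb _ _)

variable {S} {p : ℝ}

lemma tendsto_log_langSum_mul
    (hp : Tendsto (fun n : ℕ => (1 / (n : ℝ)) * Real.log (langSum S a b n)) atTop (nhds p))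
    {n : ℕ} (hn : 1 ≤ n) :
    Tendsto (fun k : ℕ => (1 / (k : ℝ)) * Real.log (langSum S a b (k * n))) atTop
      (nhds (n * p)) := by
  have h := (hp.comp (tendsto_id.atTop_mul_const' (show 0 < n by omega))).const_mul (n : ℝ)
  refine h.congr fun k => ?_
  have : (n : ℝ) ≠ 0 := by positivity
  simp only [Function.comp, id, Nat.cast_mul]
  rcases eq_or_ne (k : ℝ) 0 with hk | hk
  · simp [hk]
  · field_simp

lemma exp_mul_le_langSum (ha : 0 < a) (hb : 0 < b)
    (hp : Tendsto (fun n : ℕ => (1 / (n : ℝ)) * Real.log (langSum S a b n)) atTop (nhds p))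
    {n : ℕ} (hn : 1 ≤ n) : Real.exp (n * p) ≤ langSum S a b n := by
  rw [← Real.le_log_iff_exp_le (langSum_pos S ha hb n)]
  refine le_of_tendsto (tendsto_log_langSum_mul hp hn) ?_
  filter_upwards [eventually_gt_atTop 0] with k hk
  have hk : (0 : ℝ) < k := by exact_mod_cast hk
  rw [one_div, inv_mul_le_iff₀ hk, ← Real.log_pow]
  exact Real.log_le_log (langSum_pos S ha hb _) (langSum_mul_le S ha hb n k)

lemma freeSum_le_exp_mul (ha : 0 < a) (hb : 0 < b)
    (hp : Tendsto (fun n : ℕ => (1 / (n : ℝ)) * Real.log (langSum S a b n)) atTop (nhds p))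
    (n : ℕ) : freeSum S a b n ≤ Real.exp (n * p) := by
  rcases Nat.eq_zero_or_pos n with rfl | hn
  · simp [freeSum_zero]
  rcases (freeSum_nonneg S ha hb n).eq_or_lt with h | h
  · rw [← h]; positivity
  rw [← Real.log_le_iff_le_exp h]
  refine ge_of_tendsto (tendsto_log_langSum_mul hp hn) ?_
  filter_upwards [eventually_gt_atTop 0] with k hk
  have hk : (0 : ℝ) < k := by exact_mod_cast hk
  rw [one_div, le_inv_mul_iff₀ hk, ← Real.log_pow]
  exact Real.log_le_log (by positivity)
    ((le_freeSum_mul S ha hb n k).trans (freeSum_le_langSum S ha hb _))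

lemma sum_le_sum_of_forall_exists_eq {ι κ : Type*} [DecidableEq κ] [Nonempty κ]
    {A : Finset ι} {B : Finset κ} {f : κ → ι} {g : ι → ℝ} (hg : ∀ x, 0 ≤ g x)
    (h : ∀ x ∈ A, ∃ y ∈ B, f y = x) : ∑ x ∈ A, g x ≤ ∑ y ∈ B, g (f y) := by
  choose! s hs hf using h
  have hinj : Set.InjOn s A := fun x hx y hy hxy => by rw [← hf x hx, ← hf y hy, hxy]
  calc ∑ x ∈ A, g x = ∑ y ∈ A.image s, g (f y) := by
        rw [Finset.sum_image hinj]
        exact Finset.sum_congr rfl fun x hx => by rw [hf x hx]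
    _ ≤ _ := Finset.sum_le_sum_of_subset_of_nonneg (Finset.image_subset_iff.2 hs)
        fun y _ _ => hg _

lemma langSum_le (S : Set ℕ) (ha : 0 < a) (hb : 0 < b) (n : ℕ) :
    langSum S a b n ≤
      a ^ n + b * ∑ k ∈ Finset.range n, (k + 1) * a ^ k * freeSum S a b (n - 1 - k) := by
  have hsub := Finset.sum_le_sum_of_subset_of_nonneg
    (f := wt a b) (s := langWords S n)
    (t := insert (List.replicate n false) ((langWords S n).erase (List.replicate n false)))
    (by intro w hw; by_cases h : w = List.replicate n false <;> simp [h, hw])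
    (fun w _ _ => (wt_pos ha hb w).le)
  rw [Finset.sum_insert (by simp), wt_replicate_false] at hsub
  refine hsub.trans (add_le_add_right ?_ _)
  refine (sum_le_sum_of_forall_exists_eq
    (B := (Finset.range n).sigma fun k => Finset.range (k + 1) ×ˢ freeWords S (n - 1 - k))
    (f := fun y => List.replicate y.2.1 false ++ true :: y.2.2 ++
      List.replicate (y.1 - y.2.1) false)
    (fun w => (wt_pos ha hb w).le) fun w hw => ?_).trans_eq ?_
  · rw [Finset.mem_erase, mem_langWords] at hw
    obtain ⟨hne, hl, hw⟩ := hw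
    rcases hw.eq_replicate_or_decomp with h | ⟨i, j, v, hv, rfl⟩
    · rw [hl] at h
      exact absurd h hne
    · simp only [List.length_append, List.length_replicate, List.length_cons] at hl
      refine ⟨⟨i + j, i, v⟩, ?_, by simp⟩
      simp only [Finset.mem_sigma, Finset.mem_product, Finset.mem_range, mem_freeWords]
      exact ⟨by omega, by omega, by omega, hv⟩
  · rw [Finset.sum_sigma, Finset.mul_sum]
    refine Finset.sum_congr rfl fun k _ => ?_
    rw [Finset.sum_product]
    have : ∀ i ∈ Finset.range (k + 1), ∑ v ∈ freeWords S (n - 1 - k),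
        wt a b (List.replicate i false ++ true :: v ++ List.replicate (k - i) false) =
        b * a ^ k * freeSum S a b (n - 1 - k) := by
      intro i hi
      rw [freeSum, Finset.mul_sum]
      refine Finset.sum_congr rfl fun v _ => ?_
      have hk : a ^ k = a ^ i * a ^ (k - i) := by
        rw [← pow_add, Nat.add_sub_cancel' (by simpa [Nat.lt_succ_iff] using hi)]
      simp only [wt_append, wt_cons_true, wt_replicate_false, hk]
      ring
    rw [Finset.sum_congr rfl this]
    simp
    ring

end Weights

lemma exists_forall_exists_le_of_one_le_renewal {α β : ℝ} {v : ℕ → ℝ} (hα : 0 ≤ α) (hα1 : α < 1)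
    (hβ : 0 ≤ β) (hv : ∀ n, v n ≤ 1)
    (h : ∀ n, 1 ≤ n →
      1 ≤ α ^ n + β * ∑ k ∈ Finset.range n, (k + 1) * α ^ k * v (n - 1 - k)) :
    ∃ K : ℝ, 0 < K ∧ ∃ N : ℕ, ∀ n, N ≤ n → ∃ l, n - N ≤ l ∧ l ≤ n ∧ 1 ≤ l ∧ K ≤ v l := by
  set f : ℕ → ℝ := fun k => (k + 1) * α ^ k with hf
  have hf0 : ∀ k, 0 ≤ f k := fun k => by positivity
  have hfs : Summable f := by
    have h1 : Summable fun k : ℕ => (k : ℝ) * α ^ k := by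
      simpa using summable_pow_mul_geometric_of_norm_lt_one 1
        (show ‖α‖ < 1 by rwa [Real.norm_of_nonneg hα])
    simpa [hf, add_mul] using h1.add (summable_geometric_of_lt_one hα hα1)
  set T := ∑' k, f k
  have hT : 0 ≤ T := tsum_nonneg hf0
  have htail : Tendsto (fun M => β * (T - ∑ k ∈ Finset.range M, f k)) atTop (nhds 0) := by
    simpa [T] using (hfs.hasSum.tendsto_sum_nat.const_sub T).const_mul β
  obtain ⟨M, hM⟩ := (htail.eventually_lt_const (show (0 : ℝ) < 1 / 4 by norm_num)).exists
  obtain ⟨M', hM'⟩ := eventually_atTop.1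
    ((tendsto_pow_atTop_nhds_zero_of_lt_one hα hα1).eventually_lt_const
      (show (0 : ℝ) < 1 / 4 by norm_num))
  set K := 1 / (4 * (β * T + 1)) with hK
  have hβT : 0 ≤ β * T := mul_nonneg hβ hT
  have hK0 : 0 < K := by positivity
  have hKT : β * (K * T) ≤ 1 / 4 := by
    have : β * (K * T) = (β * T) / (4 * (β * T + 1)) := by rw [hK]; ring
    rw [this, div_le_div_iff₀ (by positivity) (by norm_num)]
    linarith
  refine ⟨K, hK0, M + M' + 2, fun n hn => ?_⟩
  by_contra! hcon
  have hbound : ∀ k ∈ Finset.range n,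
      f k * v (n - 1 - k) ≤ K * f k + (f k - if k ∈ Finset.range M then f k else 0) := by
    intro k hk
    by_cases hkM : k ∈ Finset.range M
    · rw [Finset.mem_range] at hkM
      have := hcon (n - 1 - k) (by omega) (by omega) (by omega)
      rw [if_pos (Finset.mem_range.2 hkM)]
      nlinarith [hf0 k]
    · rw [if_neg hkM]
      nlinarith [hf0 k, hv (n - 1 - k), mul_nonneg hK0.le (hf0 k)]
  have hsum := Finset.sum_le_sum hbound
  rw [Finset.sum_add_distrib, Finset.sum_sub_distrib, ← Finset.mul_sum, Finset.sum_ite_mem,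
    Finset.inter_eq_right.2 (Finset.range_subset_range.2 (show M ≤ n by omega))] at hsum
  have hle : ∑ k ∈ Finset.range n, f k ≤ T := hfs.sum_le_tsum _ fun k _ => hf0 k
  have hmain : ∑ k ∈ Finset.range n, f k * v (n - 1 - k) ≤
      K * T + (T - ∑ k ∈ Finset.range M, f k) := by
    nlinarith
  have h1 := mul_le_mul_of_nonneg_left hmain hβ
  have h2 := h n (by omega)
  have h3 := hM' n (by omega)
  rw [mul_add] at h1
  linarith

/-- If c₀^t < e^{P(t)} and c₁^t < e^{P(t)}, then there are K₃ > 0 and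
N ∈ ℕ such that for every n ≥ N there is l with n − N ≤ l ≤ n and
K₃·e^{l·P(t)} ≤ ∑_{ω ∈ G_l} c_ω^t. -/
theorem stmt5
    (S : Set ℕ) (hS : S.Infinite)
    (c0 c1 cb0 cb1 : ℝ)
    (hc0 : 0 < c0) (hc0b : c0 ≤ cb0) (hcb0 : cb0 < 1)
    (hc1 : 0 < c1) (hc1b : c1 ≤ cb1) (hcb1 : cb1 < 1)
    (P Pb : ℝ → ℝ)
    (hP : ∀ t : ℝ, Filter.Tendsto
      (fun n : ℕ => (1 / (n : ℝ)) * Real.log (∑ ω ∈ langWords S n, wt c0 c1 ω ^ t))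
      Filter.atTop (nhds (P t)))
    (hPb : ∀ t : ℝ, Filter.Tendsto
      (fun n : ℕ => (1 / (n : ℝ)) * Real.log (∑ ω ∈ langWords S n, wt cb0 cb1 ω ^ t))
      Filter.atTop (nhds (Pb t)))
    (t : ℝ) (ht0 : c0 ^ t < Real.exp (P t)) (ht1 : c1 ^ t < Real.exp (P t)) :
    ∃ K₃ : ℝ, 0 < K₃ ∧ ∃ N : ℕ, ∀ n : ℕ, N ≤ n →
      ∃ l : ℕ, n - N ≤ l ∧ l ≤ n ∧
        K₃ * Real.exp (l * P t) ≤ ∑ ω ∈ coreWords S l, wt c0 c1 ω ^ t := by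
  set a := c0 ^ t
  set b := c1 ^ t
  have ha : 0 < a := Real.rpow_pos_of_pos hc0 t
  have hb : 0 < b := Real.rpow_pos_of_pos hc1 t
  set r := Real.exp (P t) with hr_def
  have hr : 0 < r := Real.exp_pos _
  have hexp : ∀ n : ℕ, Real.exp (n * P t) = r ^ n := fun n => by rw [hr_def, ← Real.exp_nat_mul]
  have hp : Tendsto (fun n : ℕ => (1 / (n : ℝ)) * Real.log (langSum S a b n)) atTop
      (nhds (P t)) := by
    simpa only [langSum, wt_rpow hc0 hc1] using hP t
  obtain ⟨K, hK, N, h⟩ := exists_forall_exists_le_of_one_le_renewal (α := a / r) (β := b / r)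
    (v := fun n => freeSum S a b n / r ^ n) (by positivity) ((div_lt_one hr).2 ht0)
    (by positivity)
    (fun n => by
      rw [div_le_one (by positivity), ← hexp]
      exact freeSum_le_exp_mul ha hb hp n)
    (fun n hn => by
      have h := (exp_mul_le_langSum ha hb hp hn).trans (langSum_le S ha hb n)
      rw [hexp, ← div_le_div_iff_of_pos_right (pow_pos hr n), div_self (by positivity)] at h
      refine h.trans_eq ?_
      rw [add_div, div_pow, Finset.mul_sum, Finset.mul_sum, Finset.sum_div]
      congr 1
      refine Finset.sum_congr rfl fun k hk => ?_
      rw [Finset.mem_range] at hk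
      have : r ^ n = r * r ^ k * r ^ (n - 1 - k) := by
        rw [← pow_succ', ← pow_add]
        congr 1
        omega
      rw [this, div_pow]
      field_simp)
  refine ⟨K, hK, N, fun n hn => ?_⟩
  obtain ⟨l, hl, hln, hl1, hKl⟩ := h n hn
  refine ⟨l, hl, hln, ?_⟩
  rw [le_div_iff₀ (by positivity)] at hKl
  rw [hexp, ← freeWords_eq_coreWords S hl1]
  simpa only [freeSum, wt_rpow hc0 hc1] using hKl
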